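/- arXiv:2302.06437 — 3 statements merged into one kernel-verified Lean document; each statement's English description precedes it below -/
import Mathlib

section
/- Let X be an uncountable Hausdorff semi-regular open Whyburn space such that the space Q_p(X,ℝ) of quasicontinuous real-valued functions on X with the topology of pointwise convergence is Fréchet–Urysohn. Then X is a Lusin space in the sense of Kunen: every nowhere dense subset of X is countable, X has at most countably many isolated points, and X is uncountable. -/
open Set Filter Topology

section Defs

variable {X : Type*}

/-- `f : X → ℝ` is quasicontinuous: for every `x` and open sets `U ∋ x`, `V ∋ f x`
there is a nonempty open `W ⊆ U` with `f '' W ⊆ V`. -/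
def Quasicontinuous [TopologicalSpace X] (f : X → ℝ) : Prop :=
  ∀ x : X, ∀ U : Set X, IsOpen U → x ∈ U → ∀ V : Set ℝ, IsOpen V → f x ∈ V →
    ∃ W : Set X, IsOpen W ∧ W.Nonempty ∧ W ⊆ U ∧ f '' W ⊆ V

/-- `Q_p(X, ℝ)`: the quasicontinuous functions with the topology of pointwise
convergence (subspace of the product topology on `X → ℝ`). -/
abbrev Qp (X : Type*) [TopologicalSpace X] : Type _ :=
  {f : X → ℝ // Quasicontinuous f}

/-- A space is semi-regular if the regular open sets (`U = int (cl U)`) form a base. -/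
def SemiRegular (X : Type*) [TopologicalSpace X] : Prop :=
  TopologicalSpace.IsTopologicalBasis {U : Set X | U = interior (closure U)}

/-- Open Whyburn space. -/
def OpenWhyburn (X : Type*) [TopologicalSpace X] : Prop :=
  ∀ A : Set X, IsOpen A → ∀ x ∈ closure A \ A,
    ∃ B : Set X, IsOpen B ∧ B ⊆ A ∧ closure B \ A = {x}

/-- A set `A` is minimally bounded if `A ⊆ cl (int A)` and `int (cl A) ⊆ A`. -/
def MinimallyBounded [TopologicalSpace X] (A : Set X) : Prop :=
  A ⊆ closure (interior A) ∧ interior (closure A) ⊆ A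

end Defs

theorem MinimallyBounded.quasicontinuous_indicator {X : Type*} [TopologicalSpace X] {M : Set X}
    (hM : MinimallyBounded M) : Quasicontinuous (M.indicator (1 : X → ℝ)) := by
  intro x U hU hxU V _ hxV
  by_cases hx : x ∈ M
  · refine ⟨U ∩ interior M, hU.inter isOpen_interior, ?_, inter_subset_left, ?_⟩
    · exact mem_closure_iff.1 (hM.1 hx) U hU hxU
    · rintro _ ⟨y, hy, rfl⟩
      rw [indicator_of_mem hx] at hxV
      rwa [indicator_of_mem (interior_subset hy.2)]
  · refine ⟨U \ closure M, hU.sdiff isClosed_closure, ?_, sdiff_subset, ?_⟩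
    · by_contra h
      rw [not_nonempty_iff_eq_empty, sdiff_eq_empty] at h
      exact hx (hM.2 (interior_maximal h hU hxU))
    · rintro _ ⟨y, hy, rfl⟩
      rw [indicator_of_notMem hx] at hxV
      rwa [indicator_of_notMem fun h => hy.2 (subset_closure h)]

theorem minimallyBounded_univ {X : Type*} [TopologicalSpace X] :
    MinimallyBounded (univ : Set X) := by
  simp [MinimallyBounded]

theorem IsOpen.minimallyBounded_closure {X : Type*} [TopologicalSpace X] {O : Set X}
    (hO : IsOpen O) : MinimallyBounded (closure O) := by
  refine ⟨closure_mono (interior_maximal subset_closure hO), ?_⟩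
  rw [closure_closure]
  exact interior_subset

theorem IsClopen.minimallyBounded {X : Type*} [TopologicalSpace X] {C : Set X}
    (hC : IsClopen C) : MinimallyBounded C :=
  hC.1.closure_eq ▸ hC.2.minimallyBounded_closure

/-- In a Fréchet–Urysohn `Qp X`, if a minimally bounded set `S` can be matched on each finite set
by minimally bounded sets having countable trace on `N`, then `S` has countable trace on `N`. -/
theorem MinimallyBounded.countable_inter_of_approx {X : Type*} [TopologicalSpace X]
    [FrechetUrysohnSpace (Qp X)] {S N : Set X} (hS : MinimallyBounded S)
    (h : ∀ K : Set X, K.Finite → ∃ C, MinimallyBounded C ∧ (∀ x ∈ K, x ∈ C ↔ x ∈ S) ∧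
      (C ∩ N).Countable) : (S ∩ N).Countable := by
  let T : Set (Qp X) := {g | ∃ C, MinimallyBounded C ∧ (C ∩ N).Countable ∧
    g.1 = C.indicator (1 : X → ℝ)}
  let f : Qp X := ⟨S.indicator 1, hS.quasicontinuous_indicator⟩
  have hf : f ∈ closure T := by
    rw [closure_subtype, mem_closure_iff]
    intro O hO hfO
    obtain ⟨K, u, hu, huO⟩ := isOpen_pi_iff.1 hO _ hfO
    obtain ⟨C, hC, hCS, hCN⟩ := h K K.finite_toSet
    refine ⟨C.indicator 1, huO fun x hx => ?_,
      ⟨⟨C.indicator 1, hC.quasicontinuous_indicator⟩, ⟨C, hC, hCN, rfl⟩, rfl⟩⟩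
    have hval : C.indicator (1 : X → ℝ) x = S.indicator 1 x := by
      by_cases hxS : x ∈ S <;> simp [hxS, hCS x hx]
    rw [hval]
    exact (hu x hx).2
  obtain ⟨g, hgT, hg⟩ := mem_closure_iff_seq_limit.1 hf
  choose C _ hCN hgC using hgT
  refine (countable_iUnion hCN).mono fun x hx => ?_
  have hlim : Tendsto (fun n => (g n).1 x) atTop (𝓝 1) := by
    have := (((continuous_apply x).comp continuous_subtype_val).tendsto f).comp hg
    simpa [f, Function.comp_def, indicator_of_mem hx.1] using this
  obtain ⟨n, hn⟩ := (hlim.eventually (lt_mem_nhds one_pos)).exists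
  rw [hgC] at hn
  exact mem_iUnion.2 ⟨n, mem_of_indicator_ne_zero hn.ne', hx.2⟩

theorem OpenWhyburn.exists_isOpen_closure_inter_subset {X : Type*} [TopologicalSpace X]
    [T1Space X] (hw : OpenWhyburn X) {N : Set X} (hN : IsClosed N) (hN' : interior N = ∅) (x : X) :
    ∃ B : Set X, IsOpen B ∧ x ∈ closure B ∧ closure B ∩ N ⊆ {x} := by
  by_cases hx : IsOpen ({x} : Set X)
  · exact ⟨{x}, hx, by simp, by simp⟩
  · have hint : interior ({x} : Set X) = ∅ := by
      rcases subset_singleton_iff_eq.1 (interior_subset (s := ({x} : Set X))) with h | h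
      · exact h
      · exact absurd (interior_eq_iff_isOpen.1 h) hx
    have hmem : x ∈ closure (N ∪ {x})ᶜ \ (N ∪ {x})ᶜ := by
      rw [closure_compl, interior_union_isClosed_of_interior_empty hN hint, hN']
      simp
    obtain ⟨B, hB, -, hBx⟩ := hw _ (hN.union isClosed_singleton).isOpen_compl x hmem
    have hxB : x ∈ closure B \ (N ∪ {x})ᶜ := by rw [hBx]; rfl
    refine ⟨B, hB, hxB.1, ?_⟩
    rw [← hBx]
    exact fun y hy => mem_sdiff_of_mem hy.1 fun h => h (Or.inl hy.2)

theorem OpenWhyburn.countable_of_isNowhereDense {X : Type*} [TopologicalSpace X] [T1Space X]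
    [FrechetUrysohnSpace (Qp X)] (hw : OpenWhyburn X) {A : Set X} (hA : IsNowhereDense A) :
    A.Countable := by
  choose B hB hxB hBN using hw.exists_isOpen_closure_inter_subset isClosed_closure hA
  have key : (univ ∩ closure A).Countable := by
    refine minimallyBounded_univ.countable_inter_of_approx fun K hK =>
      ⟨closure (⋃ x ∈ K, B x), (isOpen_biUnion fun x _ => hB x).minimallyBounded_closure,
        fun x hx => ?_, ?_⟩
    · simpa using closure_mono (subset_biUnion_of_mem hx) (hxB x)
    · refine hK.countable.mono ?_
      rw [hK.closure_biUnion, iUnion₂_inter]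
      refine iUnion₂_subset fun x hx => (hBN x).trans ?_
      simpa using hx
  exact key.mono fun x hx => mem_inter (mem_univ x) (subset_closure hx)

theorem isOpen_of_forall_isOpen_singleton {X : Type*} [TopologicalSpace X] {Q : Set X}
    (hQ : ∀ x ∈ Q, IsOpen ({x} : Set X)) : IsOpen Q := by
  rw [← biUnion_of_singleton Q]
  exact isOpen_biUnion hQ

/-- A regular open set of isolated points is countable when `Qp X` is Fréchet–Urysohn. -/
theorem countable_of_forall_isOpen_singleton {X : Type*} [TopologicalSpace X] [T1Space X]
    [FrechetUrysohnSpace (Qp X)] {Q : Set X} (hQ : ∀ x ∈ Q, IsOpen ({x} : Set X))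
    (hQ' : interior (closure Q) ⊆ Q) : Q.Countable := by
  have hmb : MinimallyBounded Q := by
    refine ⟨?_, hQ'⟩
    rw [(isOpen_of_forall_isOpen_singleton hQ).interior_eq]
    exact subset_closure
  rw [← inter_self Q]
  refine hmb.countable_inter_of_approx fun K hK => ⟨K ∩ Q, ?_, fun x hx => by simp [hx], ?_⟩
  · exact IsClopen.minimallyBounded ⟨(hK.inter_of_left Q).isClosed,
      isOpen_of_forall_isOpen_singleton fun x hx => hQ x hx.2⟩
  · exact (hK.countable.mono inter_subset_left).mono inter_subset_left

theorem Set.exists_disjoint_subsets_not_countable {α : Type*} {B : Set α} (hB : ¬ B.Countable) :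
    ∃ P Q, P ∪ Q = B ∧ Disjoint P Q ∧ ¬ P.Countable ∧ ¬ Q.Countable := by
  have hinf : B.Infinite := fun h => hB h.countable
  obtain ⟨P, Q, hPQ, hd, hc⟩ := hinf.exists_union_disjoint_cardinal_eq_of_infinite
  have hiff : P.Countable ↔ Q.Countable := by
    rw [← Cardinal.le_aleph0_iff_set_countable, ← Cardinal.le_aleph0_iff_set_countable]
    simp [hc]
  have hP : ¬ P.Countable := fun h => hB (hPQ ▸ h.union (hiff.1 h))
  exact ⟨P, Q, hPQ, hd, hP, fun h => hP (hiff.2 h)⟩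

theorem OpenWhyburn.countable_setOf_isOpen_singleton {X : Type*} [TopologicalSpace X] [T1Space X]
    [FrechetUrysohnSpace (Qp X)] (hw : OpenWhyburn X) :
    {x : X | IsOpen ({x} : Set X)}.Countable := by
  set I : Set X := {x : X | IsOpen ({x} : Set X)}
  have hIo : IsOpen I := isOpen_of_forall_isOpen_singleton fun _ h => h
  by_contra hunc
  have hreg : ∀ Q ⊆ I, ¬ Q.Countable →
      ∃ z ∈ closure I \ I, z ∈ closure Q ∧ z ∉ closure (I \ Q) := by
    intro Q hQI hQ
    by_contra! h
    refine hQ (countable_of_forall_isOpen_singleton (fun x hx => hQI hx) fun z hz => ?_)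
    have hzQ : z ∈ closure Q := interior_subset hz
    by_cases hzI : z ∈ I
    · obtain ⟨y, hy, hyQ⟩ := mem_closure_iff.1 hzQ {z} hzI rfl
      exact mem_singleton_iff.1 hy ▸ hyQ
    · have hz' := h z ⟨closure_mono hQI hzQ, hzI⟩ hzQ
      obtain ⟨y, hy, hyI, hyQ⟩ := mem_closure_iff.1 hz' _ isOpen_interior hz
      obtain ⟨w, hw, hwQ⟩ := mem_closure_iff.1 (interior_subset hy) {y} hyI rfl
      exact absurd (mem_singleton_iff.1 hw ▸ hwQ) hyQ
  have hE : (closure I \ I).Countable := by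
    refine hw.countable_of_isNowhereDense ?_
    rw [(isClosed_closure.sdiff hIo).isNowhereDense_iff]
    refine eq_empty_iff_forall_notMem.2 fun z hz => ?_
    obtain ⟨y, hy, hyI⟩ := mem_closure_iff.1 (interior_subset hz).1 _ isOpen_interior hz
    exact (interior_subset hy).2 hyI
  choose! B _ hBI hBx using hw I hIo
  have hxB : ∀ x ∈ closure I \ I, x ∈ closure (B x) := fun x hx => by
    have : x ∈ closure (B x) \ I := by rw [hBx x hx]; rfl
    exact this.1
  by_cases hcount : ∀ x ∈ closure I \ I, (B x).Countable
  · have hD : (⋃ x ∈ closure I \ I, B x).Countable := hE.biUnion hcount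
    obtain ⟨z, hz, -, hz'⟩ := hreg (I \ ⋃ x ∈ closure I \ I, B x) sdiff_subset
      fun h => hunc ((h.union hD).mono fun x hx => by
        by_cases hxD : x ∈ ⋃ x ∈ closure I \ I, B x
        · exact Or.inr hxD
        · exact Or.inl ⟨hx, hxD⟩)
    exact hz' (closure_mono (fun y hy => mem_sdiff_of_mem (hBI z hz hy) fun h => h.2 (mem_biUnion hz hy))
      (hxB z hz))
  · push Not at hcount
    obtain ⟨x, hx, hBunc⟩ := hcount
    obtain ⟨P, Q, hPQ, hd, hP, hQ⟩ := exists_disjoint_subsets_not_countable hBunc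
    have hPB : P ⊆ B x := hPQ ▸ subset_union_left
    have hQB : Q ⊆ B x := hPQ ▸ subset_union_right
    have hnot : ∀ R ⊆ B x, ¬ R.Countable → x ∉ closure (I \ R) := by
      intro R hR hRc
      obtain ⟨z, hz, hzR, hz'⟩ := hreg R (hR.trans (hBI x hx)) hRc
      have hzx : z ∈ closure (B x) \ I := ⟨closure_mono hR hzR, hz.2⟩
      rw [hBx x hx, mem_singleton_iff] at hzx
      exact hzx ▸ hz'
    have hxPQ : x ∈ closure P ∪ closure Q := by
      rw [← closure_union, hPQ]
      exact hxB x hx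
    rcases hxPQ with h | h
    · exact hnot Q hQB hQ (closure_mono
        (fun y hy => mem_sdiff_of_mem (hBI x hx (hPB hy)) (hd.notMem_of_mem_left hy)) h)
    · exact hnot P hPB hP (closure_mono
        (fun y hy => mem_sdiff_of_mem (hBI x hx (hQB hy)) (hd.notMem_of_mem_right hy)) h)

theorem qp_frechetUrysohn_uncountable_openWhyburn_lusin
    (X : Type*) [TopologicalSpace X] [T2Space X] (hsr : SemiRegular X)
    (hw : OpenWhyburn X) [Uncountable X] (hFU : FrechetUrysohnSpace (Qp X)) :
    (∀ A : Set X, IsNowhereDense A → A.Countable) ∧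
      ({x : X | IsOpen ({x} : Set X)}).Countable ∧ Uncountable X :=
  ⟨fun _ hA => hw.countable_of_isNowhereDense hA, hw.countable_setOf_isOpen_singleton,
    inferInstance⟩
end

section
/- Let X be a Hausdorff semi-regular open Whyburn space such that the set of isolated points of X is uncountable and dense in X. Then the space Q_p(X,ℝ) of quasicontinuous real-valued functions on X with the topology of pointwise convergence is not Fréchet–Urysohn. -/
open Set Filter Topology

/-- The indicator of the closure of an open set is quasicontinuous. -/
theorem quasicontinuous_indicator_closure {X : Type*} [TopologicalSpace X] {U : Set X}
    (hU : IsOpen U) : Quasicontinuous ((closure U).indicator (fun _ => (1 : ℝ))) := by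
  intro x O hO hx V _ hxV
  by_cases h : x ∈ closure U
  · refine ⟨O ∩ U, hO.inter hU, mem_closure_iff.1 h O hO hx, inter_subset_left, ?_⟩
    rintro _ ⟨y, hy, rfl⟩
    rw [indicator_of_mem (subset_closure hy.2)]
    rwa [indicator_of_mem h] at hxV
  · refine ⟨O ∩ (closure U)ᶜ, hO.inter isClosed_closure.isOpen_compl, ⟨x, hx, h⟩,
      inter_subset_left, ?_⟩
    rintro _ ⟨y, hy, rfl⟩
    rw [indicator_of_notMem hy.2]
    rwa [indicator_of_notMem h] at hxV

/-- If a regular closed set `closure V` with an uncountable subset `D` is covered by regular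
closed subsets whose traces on `D` are countable, then `Qp X` is not Fréchet–Urysohn. -/
theorem not_frechetUrysohnSpace_qp_of_regularClosed_cover {X : Type*} [TopologicalSpace X]
    {V D : Set X} (hV : IsOpen V) (hDV : D ⊆ closure V) (hD : ¬ D.Countable)
    (h : ∀ y ∈ closure V, ∃ U : Set X, IsOpen U ∧ y ∈ closure U ∧ closure U ⊆ closure V ∧
      (closure U ∩ D).Countable) :
    ¬ FrechetUrysohnSpace (Qp X) := by
  classical
  intro hFU
  let t : Qp X := ⟨_, quasicontinuous_indicator_closure hV⟩
  let A : Set (Qp X) := {f | ∃ U : Set X, IsOpen U ∧ (closure U ∩ D).Countable ∧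
    f.1 = (closure U).indicator (fun _ => (1 : ℝ))}
  have ht : t ∈ closure A := by
    have hK : ∀ K : Finset X, ∃ U : Set X, IsOpen U ∧ closure U ⊆ closure V ∧
        (closure U ∩ D).Countable ∧ ∀ y ∈ K, y ∈ closure V → y ∈ closure U := by
      intro K
      induction K using Finset.induction_on with
      | empty => exact ⟨∅, isOpen_empty, by simp, by simp, by simp⟩
      | insert a K _ ih =>
        obtain ⟨U, hU, hUV, hUD, hUK⟩ := ih
        by_cases ha : a ∈ closure V
        · obtain ⟨U', hU', haU', hUV', hUD'⟩ := h a ha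
          refine ⟨U ∪ U', hU.union hU', ?_, ?_, ?_⟩
          · rw [closure_union]
            exact union_subset hUV hUV'
          · rw [closure_union, union_inter_distrib_right]
            exact hUD.union hUD'
          · intro y hy hyV
            rw [closure_union]
            rcases Finset.mem_insert.1 hy with rfl | hy
            · exact Or.inr haU'
            · exact Or.inl (hUK y hy hyV)
        · refine ⟨U, hU, hUV, hUD, fun y hy hyV => ?_⟩
          rcases Finset.mem_insert.1 hy with rfl | hy
          · exact absurd hyV ha
          · exact hUK y hy hyV
    choose U hU hUV hUD hUK using hK
    let f : Finset X → Qp X := fun K => ⟨_, quasicontinuous_indicator_closure (hU K)⟩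
    have hf : Tendsto f atTop (𝓝 t) := by
      rw [tendsto_subtype_rng, tendsto_pi_nhds]
      intro y
      refine tendsto_const_nhds.congr' ?_
      filter_upwards [eventually_ge_atTop {y}] with K hK
      change (closure V).indicator (fun _ => (1 : ℝ)) y =
        (closure (U K)).indicator (fun _ => (1 : ℝ)) y
      by_cases hy : y ∈ closure V
      · rw [indicator_of_mem hy, indicator_of_mem (hUK K y (hK (Finset.mem_singleton_self y)) hy)]
      · rw [indicator_of_notMem hy, indicator_of_notMem fun h' => hy (hUV K h')]
    exact mem_closure_of_tendsto hf (Eventually.of_forall fun K => ⟨U K, hU K, hUD K, rfl⟩)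
  obtain ⟨g, hgA, hg⟩ := mem_closure_iff_seq_limit.1 ht
  choose U _ hUD hgU using hgA
  refine hD ((countable_iUnion hUD).mono fun d hd => ?_)
  rw [tendsto_subtype_rng, tendsto_pi_nhds] at hg
  have hd1 : t.1 d = 1 := indicator_of_mem (hDV hd) (fun _ => (1 : ℝ))
  have hgd := hg d
  rw [hd1] at hgd
  obtain ⟨n, hn⟩ := (hgd.eventually_ne one_ne_zero).exists
  rw [hgU n] at hn
  exact mem_iUnion.2 ⟨n, mem_of_indicator_ne_zero hn, hd⟩

/-- An uncountable set splits into two disjoint uncountable sets. -/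
theorem exists_disjoint_uncountable_union {α : Type*} {s : Set α} (hs : ¬ s.Countable) :
    ∃ t u : Set α, t ∪ u = s ∧ Disjoint t u ∧ ¬ t.Countable ∧ ¬ u.Countable := by
  have hinf : s.Infinite := fun h => hs h.countable
  obtain ⟨t, u, hst, hd, hcard⟩ := hinf.exists_union_disjoint_cardinal_eq_of_infinite
  have hiff : t.Countable ↔ u.Countable := by
    rw [← Cardinal.le_aleph0_iff_set_countable, hcard, Cardinal.le_aleph0_iff_set_countable]
  exact ⟨t, u, hst, hd, fun h => hs (hst ▸ h.union (hiff.1 h)),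
    fun h => hs (hst ▸ (hiff.2 h).union h)⟩

theorem qp_not_frechetUrysohn_of_uncountable_dense_isolated
    (X : Type*) [TopologicalSpace X] [T2Space X] (hsr : SemiRegular X)
    (hw : OpenWhyburn X)
    (hunc : ¬ ({x : X | IsOpen ({x} : Set X)}).Countable)
    (hdense : Dense {x : X | IsOpen ({x} : Set X)}) :
    ¬ FrechetUrysohnSpace (Qp X) := by
  set I : Set X := {x : X | IsOpen ({x} : Set X)} with hI
  have hIopen : ∀ s ⊆ I, IsOpen s := fun s hs => by
    rw [← biUnion_of_singleton s]
    exact isOpen_biUnion fun x hx => hs hx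
  have hclI : ∀ s : Set X, closure s ∩ I ⊆ s := fun s x hx => by
    obtain ⟨y, rfl, hy⟩ := mem_closure_iff.1 hx.1 {x} hx.2 rfl
    exact hy
  have hsing : ∀ V D : Set X, ∀ y ∈ I, y ∈ closure V → ∃ U : Set X, IsOpen U ∧ y ∈ closure U ∧
      closure U ⊆ closure V ∧ (closure U ∩ D).Countable := fun V D y hy hyV => by
    refine ⟨{y}, hy, subset_closure rfl, ?_, ?_⟩ <;> rw [closure_singleton]
    · exact singleton_subset_iff.2 hyV
    · exact (countable_singleton y).mono inter_subset_left
  by_cases hcount : ∀ x ∉ I, ∃ B ⊆ I, x ∈ closure B ∧ (closure B ∩ I).Countable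
  · refine not_frechetUrysohnSpace_qp_of_regularClosed_cover (D := I)
      (hIopen I subset_rfl) subset_closure hunc fun y hy => ?_
    by_cases hyI : y ∈ I
    · exact hsing I I y hyI hy
    · obtain ⟨B, hBI, hyB, hBc⟩ := hcount y hyI
      exact ⟨B, hIopen B hBI, hyB, closure_mono hBI, hBc⟩
  · push Not at hcount
    obtain ⟨x, hxI, hx⟩ := hcount
    obtain ⟨B, -, hBI, hB⟩ := hw I (hIopen I subset_rfl) x ⟨hdense x, hxI⟩
    have hxB : x ∈ closure B := (hB.ge rfl).1
    have hBunc : ¬ B.Countable := fun h => hx B hBI hxB (h.mono (hclI B))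
    have key : ∀ C D : Set X, C ∪ D = B → Disjoint C D → ¬ D.Countable → x ∈ closure C →
        ¬ FrechetUrysohnSpace (Qp X) := by
      intro C D hCD hdisj hD hxC
      have hCB : C ⊆ B := hCD ▸ subset_union_left
      have hDB : D ⊆ B := hCD ▸ subset_union_right
      refine not_frechetUrysohnSpace_qp_of_regularClosed_cover (hIopen B hBI)
        (hDB.trans subset_closure) hD fun y hy => ?_
      by_cases hyI : y ∈ I
      · exact hsing B D y hyI hy
      · obtain rfl : y = x := hB.le ⟨hy, hyI⟩
        refine ⟨C, hIopen C (hCB.trans hBI), hxC, closure_mono hCB, ?_⟩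
        have hempty : closure C ∩ D = ∅ := eq_empty_of_forall_notMem fun z hz =>
          hdisj.notMem_of_mem_left (hclI C ⟨hz.1, hBI (hDB hz.2)⟩) hz.2
        simp [hempty]
    obtain ⟨C, D, hCD, hdisj, hC, hD⟩ := exists_disjoint_uncountable_union hBunc
    have hx' := hxB
    rw [← hCD, closure_union] at hx'
    rcases hx' with hxC | hxD
    · exact key C D hCD hdisj hD hxC
    · exact key D C (by rw [union_comm, hCD]) hdisj.symm hC hxD
end

section
/- Let X be an uncountable first-countable regular Hausdorff semi-regular space such that the space Q_p(X,ℝ) of quasicontinuous real-valued functions on X with the topology of pointwise convergence is Fréchet–Urysohn. Then the space Q_p(X × X, ℝ) of quasicontinuous real-valued functions on the product space X × X with the topology of pointwise convergence is not Fréchet–Urysohn. -/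
open Set Filter Topology

/-- The indicator function of the closure of an open set is quasicontinuous. -/
theorem quasicontinuous_indicator_closure_s7 {Y : Type*} [TopologicalSpace Y] {B : Set Y}
    (hB : IsOpen B) : Quasicontinuous ((closure B).indicator (1 : Y → ℝ)) := by
  intro x U hU hxU V _ hxV
  by_cases hx : x ∈ closure B
  · refine ⟨U ∩ B, hU.inter hB, mem_closure_iff.mp hx U hU hxU, inter_subset_left, ?_⟩
    rintro _ ⟨y, hy, rfl⟩
    rw [indicator_of_mem hx] at hxV
    rwa [indicator_of_mem (subset_closure hy.2)]
  · refine ⟨U ∩ (closure B)ᶜ, hU.inter isClosed_closure.isOpen_compl, ⟨x, hxU, hx⟩,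
      inter_subset_left, ?_⟩
    rintro _ ⟨y, hy, rfl⟩
    rw [indicator_of_notMem hx] at hxV
    rwa [indicator_of_notMem hy.2]

/-- In a first-countable regular Hausdorff space, every point `p` lies in the closure of an open
set whose closure meets a given closed nowhere dense set at most in `p`. -/
theorem exists_isOpen_mem_closure_inter_subset_singleton {Y : Type*} [TopologicalSpace Y]
    [T2Space Y] [RegularSpace Y] [FirstCountableTopology Y] {N : Set Y} (hN : IsClosed N)
    (hint : interior N = ∅) (p : Y) :
    ∃ B : Set Y, IsOpen B ∧ p ∈ closure B ∧ closure B ∩ N ⊆ {p} := by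
  obtain ⟨U, hU⟩ := (𝓝 p).exists_antitone_basis
  have hV (n : ℕ) : ∃ V : Set Y, V.Nonempty ∧ IsOpen V ∧ closure V ⊆ U n ∧
      Disjoint (closure V) N := by
    have hp : p ∈ closure Nᶜ := interior_eq_empty_iff_dense_compl.mp hint p
    obtain ⟨y, hyU, hyN⟩ := mem_closure_iff_nhds.mp hp _
      (interior_mem_nhds.mpr (hU.mem n))
    obtain ⟨C, hC, hCc, hCs⟩ := exists_mem_nhds_isClosed_subset
      ((isOpen_interior.inter hN.isOpen_compl).mem_nhds ⟨hyU, hyN⟩)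
    have hcl : closure (interior C) ⊆ C := closure_minimal interior_subset hCc
    exact ⟨interior C, ⟨y, mem_interior_iff_mem_nhds.mpr hC⟩, isOpen_interior,
      fun z hz ↦ interior_subset (hCs (hcl hz)).1,
      disjoint_left.mpr fun z hz ↦ (hCs (hcl hz)).2⟩
  choose V hne hVo hVU hVN using hV
  refine ⟨⋃ n, V n, isOpen_iUnion hVo, ?_, ?_⟩
  · rw [mem_closure_iff_nhds]
    intro t ht
    obtain ⟨n, hn⟩ := hU.mem_iff.mp ht
    obtain ⟨y, hy⟩ := hne n
    exact ⟨y, hn (hVU n (subset_closure hy)), mem_iUnion.mpr ⟨n, hy⟩⟩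
  · rintro q ⟨hq, hqN⟩
    by_contra hqp
    obtain ⟨S, T, hS, hT, hqS, hpT, hST⟩ := t2_separation hqp
    obtain ⟨m, hm⟩ := hU.mem_iff.mp (hT.mem_nhds hpT)
    have hq' : q ∈ closure (⋃ n ∈ Iio m, V n) := by
      rw [mem_closure_iff]
      intro O hO hqO
      obtain ⟨y, ⟨hyO, hyS⟩, hy⟩ := mem_closure_iff.mp hq _ (hO.inter hS) ⟨hqO, hqS⟩
      obtain ⟨n, hn⟩ := mem_iUnion.mp hy
      refine ⟨y, hyO, mem_iUnion₂.mpr ⟨n, ?_, hn⟩⟩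
      by_contra hnm
      exact disjoint_left.mp hST hyS
        (hm (hU.antitone (not_lt.mp hnm) (hVU n (subset_closure hn))))
    rw [(finite_Iio m).closure_biUnion] at hq'
    obtain ⟨n, _, hn⟩ := mem_iUnion₂.mp hq'
    exact disjoint_left.mp (hVN n) hn hqN

/-- If `Qp Y` is Fréchet–Urysohn and each point of `Y` lies in the closure of an open set whose
closure meets `N` at most in that point, then `N` is countable. -/
theorem countable_of_frechetUrysohn_qp {Y : Type*} [TopologicalSpace Y]
    [FrechetUrysohnSpace (Qp Y)] {N : Set Y}
    (h : ∀ p : Y, ∃ B : Set Y, IsOpen B ∧ p ∈ closure B ∧ closure B ∩ N ⊆ {p}) :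
    N.Countable := by
  choose B hBo hpB hBN using h
  have hO (F : Finset Y) : IsOpen (⋃ p ∈ F, B p) := isOpen_biUnion fun p _ ↦ hBo p
  let f (F : Finset Y) : Qp Y := ⟨_, quasicontinuous_indicator_closure_s7 (hO F)⟩
  let g : Qp Y := ⟨_, quasicontinuous_indicator_closure_s7 isOpen_univ⟩
  have hf (F : Finset Y) {p : Y} (hp : p ∈ F) : (f F).1 p = 1 :=
    indicator_of_mem (closure_mono (subset_biUnion_of_mem (u := B) hp) (hpB p)) _
  have hg (p : Y) : g.1 p = 1 := indicator_of_mem (subset_closure (mem_univ p)) _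
  have hlim : Tendsto f atTop (𝓝 g) := by
    rw [tendsto_subtype_rng, tendsto_pi_nhds]
    intro p
    refine tendsto_const_nhds.congr' ?_
    filter_upwards [eventually_ge_atTop {p}] with F hF
    rw [hg, hf F (Finset.singleton_subset_iff.mp hF)]
  have hmem : g ∈ closure (range f) :=
    mem_closure_of_tendsto hlim (Eventually.of_forall mem_range_self)
  obtain ⟨u, hu, hug⟩ := mem_closure_iff_seq_limit.mp hmem
  choose F hF using hu
  refine (countable_iUnion fun n ↦ (F n).countable_toSet).mono fun q hq ↦ ?_
  have hq1 : Tendsto (fun n ↦ (u n).1 q) atTop (𝓝 1) := by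
    have := tendsto_pi_nhds.mp (tendsto_subtype_rng.mp hug) q
    rwa [hg] at this
  obtain ⟨n, hn⟩ := (hq1.eventually_ne one_ne_zero).exists
  rw [← hF n] at hn
  have hqc : q ∈ closure (⋃ p ∈ F n, B p) := mem_of_indicator_ne_zero hn
  rw [(F n).closure_biUnion] at hqc
  obtain ⟨p, hp, hqp⟩ := mem_iUnion₂.mp hqc
  obtain rfl : q = p := hBN p ⟨hqp, hq⟩
  exact mem_iUnion.mpr ⟨n, hp⟩

theorem qp_square_not_frechetUrysohn
    (X : Type*) [TopologicalSpace X] [T2Space X] [RegularSpace X]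
    [FirstCountableTopology X] (hsr : SemiRegular X) [Uncountable X]
    (hFU : FrechetUrysohnSpace (Qp X)) :
    ¬ FrechetUrysohnSpace (Qp (X × X)) := by
  intro hFU2
  by_cases h : ∀ x : X, IsOpen ({x} : Set X)
  · have hc : (univ : Set X).Countable := countable_of_frechetUrysohn_qp
      fun p ↦ ⟨{p}, h p, subset_closure rfl, by simp⟩
    exact not_countable (countable_univ_iff.mp hc)
  · push Not at h
    obtain ⟨x, hx⟩ := h
    have hcl : IsClosed (Prod.snd ⁻¹' {x} : Set (X × X)) :=
      isClosed_singleton.preimage continuous_snd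
    have hint : interior (Prod.snd ⁻¹' {x} : Set (X × X)) = ∅ := by
      have hx' : interior ({x} : Set X) = ∅ := by
        rcases subset_singleton_iff_eq.mp (interior_subset (s := ({x} : Set X))) with h | h
        · exact h
        · exact absurd (h ▸ isOpen_interior) hx
      rw [← isOpenMap_snd.preimage_interior_eq_interior_preimage continuous_snd, hx',
        preimage_empty]
    have hc : (Prod.snd ⁻¹' {x} : Set (X × X)).Countable := countable_of_frechetUrysohn_qp
      fun p ↦ exists_isOpen_mem_closure_inter_subset_singleton hcl hint p
    have hc' : (univ : Set X).Countable :=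
      (hc.preimage (Prod.mk_left_injective x)).mono fun y _ ↦ show (y, x).2 = x from rfl
    exact not_countable (countable_univ_iff.mp hc')
end
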